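/- Let d ∈ ℕ, m ∈ {0,1,2,3}, i ∈ {1,…,d}, c ∈ [1,∞), and let p be a probability kernel on [0,1] such that for every m' ∈ {0,…,m} and every φ ∈ C^{m'}([0,1],ℝ) the function z ↦ ∫ φ(y) p(z,dy) belongs to C^{m'}([0,1],ℝ) and satisfies ‖z ↦ ∫ φ(y) p(z,dy)‖_{C^{m'}} ≤ c ‖φ‖_{C^{m'}}. Then for every f ∈ C^m([0,1]^d,ℝ) the m-th partial derivative in the i-th coordinate, [0,1]^d ∋ x ↦ (∂^m/∂x_i^m) ∫ f(x₁,…,x_{i−1},y,x_{i+1},…,x_d) p(x_i,dy), exists and is continuous on [0,1]^d. -/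

import Mathlib

open MeasureTheory Filter

noncomputable section

/-- The unit cube `[0,1]^d` in `ℝ^d`. -/
def cube (d : ℕ) : Set (Fin d → ℝ) := Set.univ.pi fun _ => Set.Icc (0:ℝ) 1

/-- Partial derivative in coordinate `i` (within `[0,1]`, i.e. one-sided at the boundary). -/
def pd (d : ℕ) (i : Fin d) (g : (Fin d → ℝ) → ℝ) : (Fin d → ℝ) → ℝ :=
  fun x => derivWithin (fun t => g (Function.update x i t)) (Set.Icc (0:ℝ) 1) (x i)

/-- Iterated partial derivative `∂^α` (coordinates applied in a fixed order). -/
def mderiv (d : ℕ) (α : Fin d → ℕ) (f : (Fin d → ℝ) → ℝ) : (Fin d → ℝ) → ℝ :=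
  List.foldr (fun i g => (pd d i)^[α i] g) f (List.finRange d)

/-- `f ∈ C^m([0,1]^d, ℝ)`: all partial derivatives of order `0` through `m` exist
(one-sidedly at the boundary) and are continuous on the cube. -/
def MemCm (d : ℕ) : ℕ → ((Fin d → ℝ) → ℝ) → Prop
  | 0, f => ContinuousOn f (cube d)
  | m + 1, f => ContinuousOn f (cube d) ∧ ∀ i : Fin d,
      (∀ x ∈ cube d, DifferentiableWithinAt ℝ (fun t => f (Function.update x i t))
        (Set.Icc (0:ℝ) 1) (x i)) ∧
      MemCm d m (pd d i f)

/-- Sup norm over the cube: `‖g‖_∞ = sup_{x ∈ [0,1]^d} |g(x)|`. -/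
def supCube (d : ℕ) (g : (Fin d → ℝ) → ℝ) : ℝ := ⨆ x : cube d, |g x.1|

/-- The `C^m`-norm: `max_{|α| ≤ m} sup_{x ∈ [0,1]^d} |∂^α f(x)|`. -/
def CmNorm (d m : ℕ) (f : (Fin d → ℝ) → ℝ) : ℝ :=
  ⨆ α : {α : Fin d → ℕ // (∑ i, α i) ≤ m}, supCube d (mderiv d α.1 f)

/-- `λ_m := max_{0 < |α| ≤ m} ∑_i ‖∂^α b_i‖_∞`. -/
def lamNorm (d m : ℕ) (b : Fin d → (Fin d → ℝ) → ℝ) : ℝ :=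
  ⨆ α : {α : Fin d → ℕ // 0 < (∑ i, α i) ∧ (∑ i, α i) ≤ m},
    ∑ i, supCube d (mderiv d α.1 (b i))

/-- One-sided derivative within `[0,1]` for a one-dimensional function. -/
noncomputable def dI (φ : ℝ → ℝ) : ℝ → ℝ := fun z => derivWithin φ (Set.Icc (0:ℝ) 1) z

/-- `φ ∈ C^m([0,1], ℝ)`: derivatives of order `0` through `m` exist
(one-sidedly at the boundary) and are continuous on `[0,1]`. -/
def MemC1d : ℕ → (ℝ → ℝ) → Prop
  | 0, φ => ContinuousOn φ (Set.Icc (0:ℝ) 1)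
  | m + 1, φ => ContinuousOn φ (Set.Icc (0:ℝ) 1) ∧
      (∀ z ∈ Set.Icc (0:ℝ) 1, DifferentiableWithinAt ℝ φ (Set.Icc (0:ℝ) 1) z) ∧
      MemC1d m (dI φ)

/-- The `C^m`-norm of a one-dimensional function: `max_{k ≤ m} sup_{z ∈ [0,1]} |φ^{(k)}(z)|`. -/
noncomputable def C1dNorm (m : ℕ) (φ : ℝ → ℝ) : ℝ :=
  ⨆ k : Fin (m + 1), ⨆ z : Set.Icc (0:ℝ) 1, |dI^[(k : ℕ)] φ z.1|

/-- `PEC d [i₁, …, i_n] g` means: the successive partial derivatives of `g` in the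
coordinates `i₁, …, i_n` (in this order, one-sided at the boundary) exist at every point
of the cube, and the final `n`-th order partial derivative is continuous on the cube. -/
def PEC (d : ℕ) : List (Fin d) → ((Fin d → ℝ) → ℝ) → Prop
  | [], g => ContinuousOn g (cube d)
  | i :: L, g => (∀ x ∈ cube d, DifferentiableWithinAt ℝ
      (fun t => g (Function.update x i t)) (Set.Icc (0:ℝ) 1) (x i)) ∧
      PEC d L (pd d i g)
open Set in
theorem eqOn_dI {φ ψ : ℝ → ℝ} (h : EqOn φ ψ (Icc 0 1)) : EqOn (dI φ) (dI ψ) (Icc 0 1) :=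
  fun _ hz => derivWithin_congr h (h hz)

open Set in
theorem eqOn_iterate_dI (k : ℕ) {φ ψ : ℝ → ℝ} (h : EqOn φ ψ (Icc 0 1)) :
    EqOn (dI^[k] φ) (dI^[k] ψ) (Icc 0 1) := by
  induction k generalizing φ ψ with
  | zero => exact h
  | succ k ih => exact ih (eqOn_dI h)

open Set in
theorem MemC1d.congr {m : ℕ} {φ ψ : ℝ → ℝ} (hφ : MemC1d m φ) (h : EqOn ψ φ (Icc 0 1)) :
    MemC1d m ψ := by
  induction m generalizing φ ψ with
  | zero => exact ContinuousOn.congr hφ h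
  | succ m ih =>
    exact ⟨hφ.1.congr h, fun z hz => (hφ.2.1 z hz).congr h (h hz), ih hφ.2.2 (eqOn_dI h)⟩

theorem MemC1d.continuousOn {m : ℕ} {φ : ℝ → ℝ} (hφ : MemC1d m φ) :
    ContinuousOn φ (Set.Icc 0 1) := by
  cases m with
  | zero => exact hφ
  | succ m => exact hφ.1

theorem MemC1d.continuousOn_iterate_dI {m k : ℕ} {φ : ℝ → ℝ} (hφ : MemC1d m φ) (hk : k ≤ m) :
    ContinuousOn (dI^[k] φ) (Set.Icc 0 1) := by
  induction k generalizing m φ with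
  | zero => exact hφ.continuousOn
  | succ k ih =>
    cases m with
    | zero => omega
    | succ m => exact ih hφ.2.2 (Nat.le_of_succ_le_succ hk)

open Set in
theorem eqOn_dI_sub {φ ψ : ℝ → ℝ}
    (hφ : ∀ z ∈ Icc (0 : ℝ) 1, DifferentiableWithinAt ℝ φ (Icc 0 1) z)
    (hψ : ∀ z ∈ Icc (0 : ℝ) 1, DifferentiableWithinAt ℝ ψ (Icc 0 1) z) :
    EqOn (dI (fun t => φ t - ψ t)) (fun t => dI φ t - dI ψ t) (Icc 0 1) :=
  fun z hz => derivWithin_fun_sub (hφ z hz) (hψ z hz)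

theorem MemC1d.sub {m : ℕ} {φ ψ : ℝ → ℝ} (hφ : MemC1d m φ) (hψ : MemC1d m ψ) :
    MemC1d m (fun t => φ t - ψ t) := by
  induction m generalizing φ ψ with
  | zero => exact ContinuousOn.sub hφ hψ
  | succ m ih =>
    exact ⟨hφ.1.sub hψ.1, fun z hz => (hφ.2.1 z hz).sub (hψ.2.1 z hz),
      (ih hφ.2.2 hψ.2.2).congr (eqOn_dI_sub hφ.2.1 hψ.2.1)⟩

theorem MemC1d.iterate_dI_sub {m k : ℕ} {φ ψ : ℝ → ℝ} (hφ : MemC1d m φ) (hψ : MemC1d m ψ)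
    (hk : k ≤ m) {z : ℝ} (hz : z ∈ Set.Icc (0 : ℝ) 1) :
    dI^[k] (fun t => φ t - ψ t) z = dI^[k] φ z - dI^[k] ψ z := by
  induction k generalizing m φ ψ with
  | zero => rfl
  | succ k ih =>
    cases m with
    | zero => omega
    | succ m =>
      exact (eqOn_iterate_dI k (eqOn_dI_sub hφ.2.1 hψ.2.1) hz).trans
        (ih hφ.2.2 hψ.2.2 (Nat.le_of_succ_le_succ hk))

theorem MemC1d.abs_iterate_dI_le_C1dNorm {m : ℕ} {φ : ℝ → ℝ} (hφ : MemC1d m φ) {z : ℝ}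
    (hz : z ∈ Set.Icc (0 : ℝ) 1) : |dI^[m] φ z| ≤ C1dNorm m φ := by
  have hbdd : BddAbove (Set.range fun z : Set.Icc (0 : ℝ) 1 => |dI^[m] φ z.1|) := by
    have := (isCompact_Icc (a := (0 : ℝ)) (b := 1)).bddAbove_image
      (hφ.continuousOn_iterate_dI le_rfl).abs
    rwa [Set.image_eq_range] at this
  exact (le_ciSup hbdd ⟨z, hz⟩).trans
    (le_ciSup (f := fun k : Fin (m + 1) => ⨆ z : Set.Icc (0 : ℝ) 1, |dI^[(k : ℕ)] φ z.1|)
      (Set.finite_range _).bddAbove (Fin.last m))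

theorem C1dNorm_le {m : ℕ} {φ : ℝ → ℝ} {ε : ℝ}
    (h : ∀ k ≤ m, ∀ z ∈ Set.Icc (0 : ℝ) 1, |dI^[k] φ z| ≤ ε) : C1dNorm m φ ≤ ε := by
  have : Nonempty (Set.Icc (0 : ℝ) 1) := ⟨⟨0, by simp⟩⟩
  exact ciSup_le fun k => ciSup_le fun z => h k (Nat.le_of_lt_succ k.2) z z.2

theorem update_mem_cube {d : ℕ} {x : Fin d → ℝ} (hx : x ∈ cube d) (i : Fin d) {t : ℝ}
    (ht : t ∈ Set.Icc (0 : ℝ) 1) : Function.update x i t ∈ cube d := by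
  intro j _
  by_cases h : j = i
  · subst h
    simpa using ht
  · simpa [h] using hx j trivial

theorem dI_slice {d : ℕ} (i : Fin d) (g : (Fin d → ℝ) → ℝ) (x : Fin d → ℝ) :
    dI (fun t => g (Function.update x i t)) = fun t => pd d i g (Function.update x i t) := by
  funext t
  simp [dI, pd]

theorem iterate_dI_slice {d : ℕ} (i : Fin d) (k : ℕ) (g : (Fin d → ℝ) → ℝ) (x : Fin d → ℝ) :
    dI^[k] (fun t => g (Function.update x i t)) =
      fun t => (pd d i)^[k] g (Function.update x i t) := by
  induction k generalizing g with
  | zero => rfl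
  | succ k ih => rw [Function.iterate_succ_apply, dI_slice, ih, Function.iterate_succ_apply]

theorem MemCm.continuousOn {d m : ℕ} {f : (Fin d → ℝ) → ℝ} (hf : MemCm d m f) :
    ContinuousOn f (cube d) := by
  cases m with
  | zero => exact hf
  | succ m => exact hf.1

theorem MemCm.continuousOn_iterate_pd {d m k : ℕ} {f : (Fin d → ℝ) → ℝ} (hf : MemCm d m f)
    (i : Fin d) (hk : k ≤ m) : ContinuousOn ((pd d i)^[k] f) (cube d) := by
  induction k generalizing m f with
  | zero => exact hf.continuousOn
  | succ k ih =>
    cases m with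
    | zero => omega
    | succ m => exact ih (hf.2 i).2 (Nat.le_of_succ_le_succ hk)

theorem MemCm.slice {d m : ℕ} {f : (Fin d → ℝ) → ℝ} (hf : MemCm d m f) (i : Fin d)
    {x : Fin d → ℝ} (hx : x ∈ cube d) : MemC1d m (fun t => f (Function.update x i t)) := by
  have hcont : ∀ {g : (Fin d → ℝ) → ℝ}, ContinuousOn g (cube d) →
      ContinuousOn (fun t => g (Function.update x i t)) (Set.Icc 0 1) := fun hg =>
    hg.comp ((continuous_const (y := x)).update i continuous_id).continuousOn
      fun _ ht => update_mem_cube hx i ht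
  induction m generalizing f with
  | zero => exact hcont hf
  | succ m ih =>
    refine ⟨hcont hf.1, fun z hz => ?_, ?_⟩
    · simpa using (hf.2 i).1 _ (update_mem_cube hx i hz)
    · rw [dI_slice]
      exact ih (hf.2 i).2

theorem PEC_replicate {d m : ℕ} {i : Fin d} {g : (Fin d → ℝ) → ℝ}
    (hg : ∀ x ∈ cube d, MemC1d m (fun t => g (Function.update x i t)))
    (hcont : ContinuousOn ((pd d i)^[m] g) (cube d)) : PEC d (List.replicate m i) g := by
  induction m generalizing g with
  | zero => exact hcont
  | succ m ih =>
    refine ⟨fun x hx => (hg x hx).2.1 _ (hx i trivial), ih (fun x hx => ?_) hcont⟩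
    rw [← dI_slice]
    exact (hg x hx).2.2

open Topology in
theorem eventually_forall_abs_slice_sub_lt {d : ℕ} (i : Fin d) {h : (Fin d → ℝ) → ℝ}
    (hh : ContinuousOn h (cube d)) {a : Fin d → ℝ} (ha : a ∈ cube d) {ε : ℝ} (hε : 0 < ε) :
    ∀ᶠ x in 𝓝[cube d] a, ∀ t ∈ Set.Icc (0 : ℝ) 1,
      |h (Function.update x i t) - h (Function.update a i t)| < ε := by
  have hcomp : IsCompact (cube d) := isCompact_univ_pi fun _ => isCompact_Icc
  obtain ⟨δ, hδ, hu⟩ :=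
    Metric.uniformContinuousOn_iff.1 (hcomp.uniformContinuousOn_of_continuous hh) ε hε
  filter_upwards [self_mem_nhdsWithin, mem_nhdsWithin_of_mem_nhds (Metric.ball_mem_nhds a hδ)]
    with x hx hxa t ht
  refine hu _ (update_mem_cube hx i ht) _ (update_mem_cube ha i ht) ?_
  refine lt_of_le_of_lt ((dist_pi_le_iff dist_nonneg).2 fun j => ?_) hxa
  by_cases hj : j = i
  · subst hj
    simp
  · simpa [hj] using dist_le_pi_dist x a j

theorem ContinuousOn.integrable_of_measure_compl_Icc_eq_zero {μ : Measure ℝ} [IsFiniteMeasure μ]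
    (hμ : μ (Set.Icc (0 : ℝ) 1)ᶜ = 0) {φ : ℝ → ℝ} (hφ : ContinuousOn φ (Set.Icc 0 1)) :
    Integrable φ μ := by
  have := hφ.integrableOn_compact (μ := μ) isCompact_Icc
  rwa [IntegrableOn, Measure.restrict_eq_self_of_ae_mem
    (show ∀ᵐ y ∂μ, y ∈ Set.Icc (0 : ℝ) 1 from hμ)] at this

/-- Continuity of pure derivatives, single kernel: if the kernel `p` maps `C^{m'}([0,1],ℝ)`
into itself with operator norm at most `c` for all `m' ≤ m`, then for `f ∈ C^m([0,1]^d,ℝ)`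
the `m`-th partial derivative in the `i`-th coordinate of
`x ↦ ∫ f(x₁,…,x_{i−1},y,x_{i+1},…,x_d) p(x_i,dy)` exists and is continuous on `[0,1]^d`. -/
theorem continuity_pure_derivatives_single_kernel
    (d : ℕ) (hd : 0 < d) (m : ℕ) (hm : m ≤ 3) (i : Fin d) (c : ℝ) (hc : 1 ≤ c)
    (p : ℝ → Measure ℝ)
    [∀ z, IsProbabilityMeasure (p z)]
    (hmeas : Measurable p)
    (hsupp : ∀ z, p z (Set.Icc (0:ℝ) 1)ᶜ = 0)
    (hp : ∀ m' ≤ m, ∀ φ : ℝ → ℝ, MemC1d m' φ →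
      MemC1d m' (fun z => ∫ y, φ y ∂ p z) ∧
      C1dNorm m' (fun z => ∫ y, φ y ∂ p z) ≤ c * C1dNorm m' φ)
    (f : (Fin d → ℝ) → ℝ) (hf : MemCm d m f) :
    PEC d (List.replicate m i)
      (fun x : Fin d → ℝ => ∫ y, f (Function.update x i y) ∂ p (x i)) := by
  set g : (Fin d → ℝ) → ℝ := fun x => ∫ y, f (Function.update x i y) ∂ p (x i) with hg_def
  have hslice : ∀ x : Fin d → ℝ, (fun t => g (Function.update x i t)) =
      fun z => ∫ y, f (Function.update x i y) ∂ p z := by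
    intro x
    funext t
    simp [hg_def]
  have hgC : ∀ x ∈ cube d, MemC1d m (fun t => g (Function.update x i t)) := by
    intro x hx
    rw [hslice]
    exact (hp m le_rfl _ (hf.slice i hx)).1
  have hpd : ∀ x : Fin d → ℝ,
      (pd d i)^[m] g x = dI^[m] (fun t => g (Function.update x i t)) (x i) := by
    intro x
    simp [iterate_dI_slice]
  refine PEC_replicate hgC fun a ha => ?_
  have hbound : ∀ ε > 0, ∀ᶠ x in nhdsWithin a (cube d), ∀ z ∈ Set.Icc (0 : ℝ) 1,
      |dI^[m] (fun t => g (Function.update x i t)) z -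
        dI^[m] (fun t => g (Function.update a i t)) z| ≤ c * ε := by
    intro ε hε
    have hev : ∀ᶠ x in nhdsWithin a (cube d), ∀ k ∈ Set.Iic m, ∀ t ∈ Set.Icc (0 : ℝ) 1,
        |(pd d i)^[k] f (Function.update x i t) - (pd d i)^[k] f (Function.update a i t)| < ε :=
      (Filter.eventually_all_finite (Set.finite_Iic m)).2 fun k hk =>
        eventually_forall_abs_slice_sub_lt i (hf.continuousOn_iterate_pd i hk) ha hε
    filter_upwards [hev, self_mem_nhdsWithin] with x hx hxc z hz
    have hfx := hf.slice i hxc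
    have hfa := hf.slice i ha
    have hsub : (fun z => ∫ y, (f (Function.update x i y) - f (Function.update a i y)) ∂ p z) =
        fun z => g (Function.update x i z) - g (Function.update a i z) := by
      funext z
      rw [integral_sub
        (hfx.continuousOn.integrable_of_measure_compl_Icc_eq_zero (hsupp z))
        (hfa.continuousOn.integrable_of_measure_compl_Icc_eq_zero (hsupp z))]
      simp [hg_def]
    have hP := hp m le_rfl _ (hfx.sub hfa)
    rw [hsub] at hP
    rw [← (hgC x hxc).iterate_dI_sub (hgC a ha) le_rfl hz]
    refine (hP.1.abs_iterate_dI_le_C1dNorm hz).trans (hP.2.trans ?_)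
    refine mul_le_mul_of_nonneg_left (C1dNorm_le fun k hk t ht => ?_) (by linarith)
    rw [hfx.iterate_dI_sub hfa hk ht, iterate_dI_slice, iterate_dI_slice]
    exact (hx k hk t ht).le
  have hlast : ContinuousWithinAt
      (fun x : Fin d → ℝ => dI^[m] (fun t => g (Function.update a i t)) (x i)) (cube d) a :=
    (((hgC a ha).continuousOn_iterate_dI le_rfl).comp (continuous_apply i).continuousOn
      fun _ (hx : _ ∈ cube d) => hx i trivial) a ha
  rw [ContinuousWithinAt, Metric.tendsto_nhds] at hlast ⊢
  intro ε hε
  have hc0 : 0 < c := by linarith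
  filter_upwards [hbound (ε / (2 * c)) (by positivity), hlast (ε / 2) (by positivity),
    self_mem_nhdsWithin] with x h₁ h₂ hx
  have h₃ := h₁ (x i) (hx i trivial)
  have hhalf : c * (ε / (2 * c)) = ε / 2 := by field_simp
  rw [hhalf] at h₃
  rw [hpd x, hpd a]
  refine (dist_triangle _ (dI^[m] (fun t => g (Function.update a i t)) (x i)) _).trans_lt ?_
  rw [← Real.dist_eq] at h₃
  linarith

end
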